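/- Fix s, m : ℕ with s + m ≥ 1, complex numbers η₁, …, η_m with |η_i| < 1 for all i, and g₀ ∈ ℂ with |g₀| = 1. Define polynomials f(z) = z^s ∏_{i=1}^m (z - η_i) and g(z) = g₀ ∏_{i=1}^m (1 - z · conj(η_i)). Then for every α ∈ ℂ with |α| = 1, all roots of the polynomial f(z) + α g(z) are simple; that is, f(z) + α g(z) and its derivative have no common root. -/

import Mathlib

open Polynomial Complex

theorem Finset.prod_lt_prod_of_nonneg_of_lt {ι : Type*} {t : Finset ι} (ht : t.Nonempty)
    {a b : ι → ℝ} (ha : ∀ i, 0 ≤ a i) (hab : ∀ i, a i < b i) :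
    ∏ i ∈ t, a i < ∏ i ∈ t, b i := by
  induction ht using Finset.Nonempty.cons_induction with
  | singleton i => simpa using hab i
  | cons i t hi _ ih =>
    rw [Finset.prod_cons, Finset.prod_cons]
    exact mul_lt_mul'' (hab i) ih (ha i) (Finset.prod_nonneg fun j _ => ha j)

theorem Polynomial.eval_derivative_prod_eq_mul_sum {K ι : Type*} [Field K] (t : Finset ι)
    (p : ι → K[X]) (z : K) (hp : ∀ i, (p i).eval z ≠ 0) :
    (derivative (∏ i ∈ t, p i)).eval z =
      (∏ i ∈ t, (p i).eval z) * ∑ i ∈ t, (derivative (p i)).eval z / (p i).eval z := by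
  classical
  induction t using Finset.induction_on with
  | empty => simp
  | insert i t hi ih =>
    rw [Finset.prod_insert hi, Finset.prod_insert hi, Finset.sum_insert hi, derivative_mul,
      eval_add, eval_mul, eval_mul, ih, eval_prod]
    have := hp i
    field_simp

theorem Complex.sq_norm_sub_sub_sq_norm_one_sub_conj_mul (z w : ℂ) :
    ‖z - w‖ ^ 2 - ‖1 - (starRingEnd ℂ) w * z‖ ^ 2 = (‖z‖ ^ 2 - 1) * (1 - ‖w‖ ^ 2) := by
  simp only [Complex.sq_norm, Complex.normSq_apply, Complex.sub_re, Complex.sub_im,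
    Complex.mul_re, Complex.mul_im, Complex.conj_re, Complex.conj_im, Complex.one_re,
    Complex.one_im]
  ring

theorem Complex.norm_sub_lt_norm_one_sub_conj_mul {z w : ℂ} (hz : ‖z‖ < 1) (hw : ‖w‖ < 1) :
    ‖z - w‖ < ‖1 - (starRingEnd ℂ) w * z‖ := by
  have h := sq_norm_sub_sub_sq_norm_one_sub_conj_mul z w
  have hz2 : ‖z‖ ^ 2 < 1 := pow_lt_one₀ (norm_nonneg z) hz two_ne_zero
  have hw2 : ‖w‖ ^ 2 < 1 := pow_lt_one₀ (norm_nonneg w) hw two_ne_zero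
  refine lt_of_pow_lt_pow_left₀ 2 (norm_nonneg _) ?_
  nlinarith [mul_pos (sub_pos.2 hz2) (sub_pos.2 hw2)]

theorem Complex.norm_one_sub_conj_mul_lt_norm_sub {z w : ℂ} (hz : 1 < ‖z‖) (hw : ‖w‖ < 1) :
    ‖1 - (starRingEnd ℂ) w * z‖ < ‖z - w‖ := by
  have h := sq_norm_sub_sub_sq_norm_one_sub_conj_mul z w
  have hz2 : 1 < ‖z‖ ^ 2 := one_lt_pow₀ hz two_ne_zero
  have hw2 : ‖w‖ ^ 2 < 1 := pow_lt_one₀ (norm_nonneg w) hw two_ne_zero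
  refine lt_of_pow_lt_pow_left₀ 2 (norm_nonneg _) ?_
  nlinarith [mul_pos (sub_pos.2 hz2) (sub_pos.2 hw2)]

/-- A finite Blaschke product is unimodular only on the unit circle. -/
theorem norm_eq_one_of_norm_blaschke_eq {s m : ℕ} (hsm : 1 ≤ s + m) {η : Fin m → ℂ}
    (hη : ∀ i, ‖η i‖ < 1) {z : ℂ}
    (h : ‖z‖ ^ s * ∏ i, ‖z - η i‖ = ∏ i, ‖1 - (starRingEnd ℂ) (η i) * z‖) : ‖z‖ = 1 := by
  rcases Nat.eq_zero_or_pos s with rfl | hs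
  · have : NeZero m := ⟨by omega⟩
    rw [pow_zero, one_mul] at h
    rcases lt_trichotomy ‖z‖ 1 with hz | hz | hz
    · exact absurd h (Finset.prod_lt_prod_of_nonneg_of_lt Finset.univ_nonempty
        (fun _ => norm_nonneg _)
        fun i => Complex.norm_sub_lt_norm_one_sub_conj_mul hz (hη i)).ne
    · exact hz
    · exact absurd h (Finset.prod_lt_prod_of_nonneg_of_lt Finset.univ_nonempty
        (fun _ => norm_nonneg _)
        fun i => Complex.norm_one_sub_conj_mul_lt_norm_sub hz (hη i)).ne'
  · rcases lt_trichotomy ‖z‖ 1 with hz | hz | hz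
    · have hlt i := Complex.norm_sub_lt_norm_one_sub_conj_mul hz (hη i)
      have hpos : 0 < ∏ i, ‖1 - (starRingEnd ℂ) (η i) * z‖ :=
        Finset.prod_pos fun i _ => (norm_nonneg _).trans_lt (hlt i)
      have hle : ∏ i, ‖z - η i‖ ≤ ∏ i, ‖1 - (starRingEnd ℂ) (η i) * z‖ :=
        Finset.prod_le_prod (fun i _ => norm_nonneg _) fun i _ => (hlt i).le
      have hzs : ‖z‖ ^ s < 1 := pow_lt_one₀ (norm_nonneg z) hz hs.ne'
      have := mul_le_mul_of_nonneg_left hle (pow_nonneg (norm_nonneg z) s)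
      nlinarith
    · exact hz
    · have hlt i := Complex.norm_one_sub_conj_mul_lt_norm_sub hz (hη i)
      have hpos : 0 < ∏ i, ‖z - η i‖ :=
        Finset.prod_pos fun i _ => (norm_nonneg _).trans_lt (hlt i)
      have hle : ∏ i, ‖1 - (starRingEnd ℂ) (η i) * z‖ ≤ ∏ i, ‖z - η i‖ :=
        Finset.prod_le_prod (fun i _ => norm_nonneg _) fun i _ => (hlt i).le
      have hzs : 1 < ‖z‖ ^ s := one_lt_pow₀ hz hs.ne'
      nlinarith

/-- On the unit circle, the logarithmic derivative of a Blaschke factor is the Poisson kernel. -/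
theorem Complex.mul_logDeriv_blaschke_factor {z w : ℂ} (hz : ‖z‖ = 1) (hw : ‖w‖ < 1) :
    z * (1 / (z - w) - -(starRingEnd ℂ) w / (1 - (starRingEnd ℂ) w * z)) =
      (((1 - ‖w‖ ^ 2) / ‖z - w‖ ^ 2 : ℝ) : ℂ) := by
  have hz0 : z ≠ 0 := norm_ne_zero_iff.1 (by rw [hz]; exact one_ne_zero)
  have hzw : z - w ≠ 0 := sub_ne_zero.2 fun h => by rw [h] at hz; exact hw.ne hz
  have hcw : (starRingEnd ℂ) (z - w) ≠ 0 := (_root_.map_ne_zero _).2 hzw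
  have hzz : z * (starRingEnd ℂ) z = 1 := by rw [Complex.mul_conj', hz]; norm_num
  have hfac : 1 - (starRingEnd ℂ) w * z = z * (starRingEnd ℂ) (z - w) := by
    rw [map_sub, mul_sub, hzz]; ring
  push_cast
  rw [← Complex.mul_conj', ← Complex.mul_conj', hfac]
  field_simp
  rw [map_sub]
  linear_combination hzz

/-- If `f(z) = z^s ∏ (z - ηᵢ)` with all `|ηᵢ| < 1`, `g(z) = g₀ ∏ (1 - z·conj ηᵢ)` with
`|g₀| = 1`, and `|α| = 1`, then all roots of the polynomial `f + α g` are simple: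
`f + α g` and its derivative have no common root. -/
theorem roots_simple_on_unit_circle (s m : ℕ) (hsm : 1 ≤ s + m)
    (η : Fin m → ℂ) (hη : ∀ i, ‖η i‖ < 1)
    (g₀ : ℂ) (hg₀ : ‖g₀‖ = 1) (α : ℂ) (hα : ‖α‖ = 1) (z : ℂ)
    (hroot : ((X : ℂ[X]) ^ s * ∏ i, (X - C (η i))
        + C α * (C g₀ * ∏ i, (1 - C ((starRingEnd ℂ) (η i)) * X))).eval z = 0) :
    (Polynomial.derivative ((X : ℂ[X]) ^ s * ∏ i, (X - C (η i))
        + C α * (C g₀ * ∏ i, (1 - C ((starRingEnd ℂ) (η i)) * X)))).eval z ≠ 0 := by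
  have hz : ‖z‖ = 1 := by
    refine norm_eq_one_of_norm_blaschke_eq hsm hη ?_
    have h := congrArg norm (eq_neg_of_add_eq_zero_left ((eval_add ..).symm.trans hroot))
    simpa [eval_prod, hα, hg₀, norm_prod] using h
  have hz0 : z ≠ 0 := norm_ne_zero_iff.1 (by rw [hz]; exact one_ne_zero)
  have hf i : (X - C (η i)).eval z ≠ 0 := by
    rw [eval_sub, eval_X, eval_C]
    exact sub_ne_zero.2 fun h => (hη i).ne (h ▸ hz)
  have hg i : (1 - C ((starRingEnd ℂ) (η i)) * X).eval z ≠ 0 := by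
    intro h
    have h' := Complex.sq_norm_sub_sub_sq_norm_one_sub_conj_mul z (η i)
    simp only [eval_sub, eval_one, eval_mul, eval_C, eval_X] at h
    rw [h, hz] at h'
    exact hf i (by simpa using h')
  intro hder
  rw [derivative_add, derivative_mul, derivative_C_mul, derivative_C_mul, derivative_X_pow] at hder
  simp only [eval_add, eval_mul, eval_C, eval_pow, eval_X,
    eval_derivative_prod_eq_mul_sum _ _ z hf, eval_derivative_prod_eq_mul_sum _ _ z hg,
    eval_prod] at hder hroot
  set F := ∏ i, (X - C (η i)).eval z
  set G := ∏ i, (1 - C ((starRingEnd ℂ) (η i)) * X).eval z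
  have hF : F ≠ 0 := Finset.prod_ne_zero_iff.2 fun i _ => hf i
  have hsum : (s : ℂ) + ∑ i, (((1 - ‖η i‖ ^ 2) / ‖z - η i‖ ^ 2 : ℝ) : ℂ) = 0 := by
    simp_rw [← fun i => Complex.mul_logDeriv_blaschke_factor hz (hη i)]
    rw [← Finset.mul_sum, Finset.sum_sub_distrib]
    have hS : ∑ i, (derivative (X - C (η i))).eval z / (X - C (η i)).eval z =
        ∑ i, 1 / (z - η i) := by simp
    have hT : ∑ i, (derivative (1 - C ((starRingEnd ℂ) (η i)) * X)).eval z /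
          (1 - C ((starRingEnd ℂ) (η i)) * X).eval z =
        ∑ i, -(starRingEnd ℂ) (η i) / (1 - (starRingEnd ℂ) (η i) * z) := by simp
    rw [hS, hT] at hder
    have hzs : (s : ℂ) * z ^ (s - 1) * z = s * z ^ s := by
      cases s with
      | zero => simp
      | succ n => rw [Nat.add_sub_cancel, pow_succ, mul_assoc]
    refine (mul_eq_zero.1 ?_).resolve_left (mul_ne_zero (pow_ne_zero s hz0) hF)
    linear_combination z * hder - z * (∑ i, -(starRingEnd ℂ) (η i) /
      (1 - (starRingEnd ℂ) (η i) * z)) * hroot - F * hzs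
  have hpos i : 0 < (1 - ‖η i‖ ^ 2) / ‖z - η i‖ ^ 2 := by
    refine div_pos (sub_pos.2 (pow_lt_one₀ (norm_nonneg _) (hη i) two_ne_zero)) ?_
    exact pow_pos (norm_pos_iff.2 (by simpa using hf i)) 2
  have hsum' : (s : ℝ) + ∑ i, (1 - ‖η i‖ ^ 2) / ‖z - η i‖ ^ 2 = 0 := by exact_mod_cast hsum
  rcases Nat.eq_zero_or_pos s with rfl | hs
  · have : NeZero m := ⟨by omega⟩
    have := Finset.sum_pos (fun i _ => hpos i) (Finset.univ_nonempty (α := Fin m))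
    simp at hsum'
    linarith
  · have := Finset.sum_nonneg fun i (_ : i ∈ Finset.univ) => (hpos i).le
    have : (0 : ℝ) < s := Nat.cast_pos.2 hs
    linarith
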